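/- Let Λ be an n×r matrix and Γ^F an r×r symmetric positive definite matrix, and set Γ^χ = Λ Γ^F Λ'. Then for each j = 1,…,r, the j-th largest eigenvalue of Γ^χ satisfies ν_min(Γ^F)·ν_j(Λ'Λ) ≤ ν_j(Γ^χ) ≤ ν_max(Γ^F)·ν_j(Λ'Λ). -/

import Mathlib

open Matrix

/-- The `j`-th largest eigenvalue of a Hermitian matrix. -/
noncomputable def eigDesc {n : ℕ} {A : Matrix (Fin n) (Fin n) ℝ} (hA : A.IsHermitian)
    (j : Fin n) : ℝ :=
  hA.eigenvalues (Tuple.sort hA.eigenvalues j.rev)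

/-- The coordinates of `x` in the orthonormal eigenbasis of `A` diagonalize the quadratic form. -/
lemma Matrix.IsHermitian.dotProduct_mulVec_eq_sum {n : ℕ} {A : Matrix (Fin n) (Fin n) ℝ}
    (hA : A.IsHermitian) (x : Fin n → ℝ) :
    x ⬝ᵥ A *ᵥ x = ∑ i, hA.eigenvalues i *
      ((hA.eigenvectorUnitary.1ᵀ *ᵥ x) i) ^ 2 := by
  set U : Matrix (Fin n) (Fin n) ℝ := hA.eigenvectorUnitary.1 with hU
  have h : A = U * diagonal hA.eigenvalues * Uᵀ := by
    have := hA.spectral_theorem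
    rw [Unitary.conjStarAlgAut_apply] at this
    simpa [hU, star_eq_conjTranspose, Function.comp_def] using this
  conv_lhs => rw [h]
  rw [← mulVec_mulVec, ← mulVec_mulVec, dotProduct_mulVec, ← mulVec_transpose]
  simp only [dotProduct, mulVec_diagonal]
  exact Finset.sum_congr rfl fun i _ => by ring

lemma Matrix.IsHermitian.dotProduct_self_eq_sum {n : ℕ} {A : Matrix (Fin n) (Fin n) ℝ}
    (hA : A.IsHermitian) (x : Fin n → ℝ) :
    x ⬝ᵥ x = ∑ i, ((hA.eigenvectorUnitary.1ᵀ *ᵥ x) i) ^ 2 := by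
  set U : Matrix (Fin n) (Fin n) ℝ := hA.eigenvectorUnitary.1 with hU
  have h : U * Uᵀ = 1 := by
    have := Unitary.coe_mul_star_self hA.eigenvectorUnitary
    simpa [hU, star_eq_conjTranspose] using this
  have h2 : x ⬝ᵥ x = x ⬝ᵥ (U * Uᵀ) *ᵥ x := by rw [h, one_mulVec]
  rw [h2, ← mulVec_mulVec, dotProduct_mulVec, ← mulVec_transpose]
  simp only [dotProduct]
  exact Finset.sum_congr rfl fun i _ => by ring

lemma Matrix.IsHermitian.iInf_eigenvalues_mul_le {n : ℕ} {A : Matrix (Fin n) (Fin n) ℝ}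
    (hA : A.IsHermitian) (x : Fin n → ℝ) :
    (⨅ i, hA.eigenvalues i) * (x ⬝ᵥ x) ≤ x ⬝ᵥ A *ᵥ x := by
  rw [hA.dotProduct_mulVec_eq_sum, hA.dotProduct_self_eq_sum, Finset.mul_sum]
  exact Finset.sum_le_sum fun i _ =>
    mul_le_mul_of_nonneg_right (ciInf_le (Set.finite_range _).bddBelow i) (sq_nonneg _)

lemma Matrix.IsHermitian.le_iSup_eigenvalues_mul {n : ℕ} {A : Matrix (Fin n) (Fin n) ℝ}
    (hA : A.IsHermitian) (x : Fin n → ℝ) :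
    x ⬝ᵥ A *ᵥ x ≤ (⨆ i, hA.eigenvalues i) * (x ⬝ᵥ x) := by
  rw [hA.dotProduct_mulVec_eq_sum, hA.dotProduct_self_eq_sum, Finset.mul_sum]
  exact Finset.sum_le_sum fun i _ =>
    mul_le_mul_of_nonneg_right (le_ciSup (Set.finite_range _).bddAbove i) (sq_nonneg _)

/-- A one-sided comparison of quadratic forms compares the numbers of eigenvalues above
the corresponding thresholds. -/
lemma Matrix.IsHermitian.card_le_eigenvalues_mono {n : ℕ} {A B : Matrix (Fin n) (Fin n) ℝ}
    (hA : A.IsHermitian) (hB : B.IsHermitian) {c d : ℝ}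
    (h : ∀ x, c * (x ⬝ᵥ x) ≤ x ⬝ᵥ A *ᵥ x → d * (x ⬝ᵥ x) ≤ x ⬝ᵥ B *ᵥ x) :
    Fintype.card {i // c ≤ hA.eigenvalues i} ≤ Fintype.card {i // d ≤ hB.eigenvalues i} := by
  set U : Matrix (Fin n) (Fin n) ℝ := hA.eigenvectorUnitary.1 with hU
  set V : Matrix (Fin n) (Fin n) ℝ := hB.eigenvectorUnitary.1 with hV
  let φ : (Fin n → ℝ) →ₗ[ℝ]
      ({i // ¬ c ≤ hA.eigenvalues i} → ℝ) × ({i // d ≤ hB.eigenvalues i} → ℝ) :=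
    ((LinearMap.funLeft ℝ ℝ Subtype.val).comp Uᵀ.mulVecLin).prod
      ((LinearMap.funLeft ℝ ℝ Subtype.val).comp Vᵀ.mulVecLin)
  have hφ : Function.Injective φ := by
    rw [← LinearMap.ker_eq_bot, LinearMap.ker_eq_bot']
    intro x hx
    have h1 : ∀ i, ¬ c ≤ hA.eigenvalues i → (Uᵀ *ᵥ x) i = 0 := fun i hi =>
      congrFun (congrArg Prod.fst hx) ⟨i, hi⟩
    have h2 : ∀ i, d ≤ hB.eigenvalues i → (Vᵀ *ᵥ x) i = 0 := fun i hi =>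
      congrFun (congrArg Prod.snd hx) ⟨i, hi⟩
    have hAx : c * (x ⬝ᵥ x) ≤ x ⬝ᵥ A *ᵥ x := by
      rw [hA.dotProduct_mulVec_eq_sum, hA.dotProduct_self_eq_sum, Finset.mul_sum]
      refine Finset.sum_le_sum fun i _ => ?_
      by_cases hi : c ≤ hA.eigenvalues i
      · exact mul_le_mul_of_nonneg_right hi (sq_nonneg _)
      · simp [← hU, h1 i hi]
    have hBx := h x hAx
    have hzero : ∀ i, (Vᵀ *ᵥ x) i = 0 := by
      by_contra! hne
      obtain ⟨k, hk⟩ := hne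
      refine hBx.not_gt ?_
      rw [hB.dotProduct_mulVec_eq_sum, hB.dotProduct_self_eq_sum, Finset.mul_sum]
      refine Finset.sum_lt_sum (fun i _ => ?_) ⟨k, Finset.mem_univ _, ?_⟩
      · by_cases hi : d ≤ hB.eigenvalues i
        · simp [← hV, h2 i hi]
        · exact mul_le_mul_of_nonneg_right (not_le.mp hi).le (sq_nonneg _)
      · exact mul_lt_mul_of_pos_right (not_le.mp fun hi => hk (h2 k hi))
          (sq_pos_of_ne_zero hk)
    have : x ⬝ᵥ x = 0 := by
      rw [hB.dotProduct_self_eq_sum]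
      exact Finset.sum_eq_zero fun i _ => by simp [← hV, hzero i]
    exact dotProduct_self_eq_zero.mp this
  have hrank := LinearMap.finrank_le_finrank_of_injective hφ
  rw [Module.finrank_prod, Module.finrank_fintype_fun_eq_card, Module.finrank_fintype_fun_eq_card,
    Module.finrank_fintype_fun_eq_card, Fintype.card_subtype_compl] at hrank
  have := Fintype.card_subtype_le fun i => c ≤ hA.eigenvalues i
  omega

lemma le_eigDesc_iff {n : ℕ} {A : Matrix (Fin n) (Fin n) ℝ} (hA : A.IsHermitian) (j : Fin n)
    (c : ℝ) : c ≤ eigDesc hA j ↔ (j : ℕ) < Fintype.card {i // c ≤ hA.eigenvalues i} := by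
  set σ := Tuple.sort hA.eigenvalues with hσ
  have hmono : Monotone (hA.eigenvalues ∘ σ) := Tuple.monotone_sort _
  have hcard : Fintype.card {i // c ≤ hA.eigenvalues i} =
      (Finset.univ.filter fun k => c ≤ hA.eigenvalues (σ k)).card := by
    rw [← Fintype.card_subtype]
    exact Fintype.card_congr (σ.subtypeEquiv fun _ => Iff.rfl).symm
  rw [hcard]
  constructor
  · intro h
    have hsub : Finset.Ici j.rev ⊆ Finset.univ.filter fun k => c ≤ hA.eigenvalues (σ k) :=
      fun k hk => by simpa using h.trans (hmono (Finset.mem_Ici.mp hk))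
    have := Finset.card_le_card hsub
    rw [Fin.card_Ici, Fin.val_rev] at this
    omega
  · intro h
    by_contra! hlt
    have hsub : (Finset.univ.filter fun k => c ≤ hA.eigenvalues (σ k)) ⊆ Finset.Ioi j.rev := by
      intro k hk
      rw [Finset.mem_Ioi]
      by_contra! hle
      exact absurd ((Finset.mem_filter.mp hk).2.trans (hmono hle)) hlt.not_ge
    have := Finset.card_le_card hsub
    rw [Fin.card_Ioi, Fin.val_rev] at this
    omega

lemma Matrix.IsHermitian.card_le_eigenvalues_eq_countP {n : ℕ} {A : Matrix (Fin n) (Fin n) ℝ}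
    (hA : A.IsHermitian) (c : ℝ) :
    Fintype.card {i // c ≤ hA.eigenvalues i} = A.charpoly.roots.countP (c ≤ ·) := by
  rw [hA.roots_charpoly_eq_eigenvalues, Multiset.countP_map, Fintype.card_subtype]
  rfl

/-- `Λ Λᵀ` and `Λᵀ Λ` have the same number of eigenvalues above any positive threshold. -/
lemma card_le_eigenvalues_mul_transpose {n r : ℕ} (hrn : r ≤ n) (Λ : Matrix (Fin n) (Fin r) ℝ)
    (h₁ : (Λ * Λᵀ).IsHermitian) (h₂ : (Λᵀ * Λ).IsHermitian) {c : ℝ} (hc : 0 < c) :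
    Fintype.card {i // c ≤ h₁.eigenvalues i} = Fintype.card {i // c ≤ h₂.eigenvalues i} := by
  rw [h₁.card_le_eigenvalues_eq_countP, h₂.card_le_eigenvalues_eq_countP,
    charpoly_mul_comm_of_le Λ Λᵀ (by simpa using hrn), Polynomial.roots_mul
      (mul_ne_zero (pow_ne_zero _ Polynomial.X_ne_zero) (charpoly_monic _).ne_zero),
    Polynomial.roots_X_pow, Multiset.countP_add, Multiset.countP_nsmul,
    Multiset.countP_eq_zero.mpr (by simpa using hc)]
  simp

/-- With `Λ` an `n×r` matrix (`r ≤ n`), `Γ^F` an `r×r` symmetric positive definite matrix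
and `Γᵡ = Λ Γ^F Λᵀ`, for each `j = 1,…,r` the `j`-th largest eigenvalue of `Γᵡ` satisfies
`ν_min(Γ^F)·ν_j(ΛᵀΛ) ≤ ν_j(Γᵡ) ≤ ν_max(Γ^F)·ν_j(ΛᵀΛ)`. -/
theorem common_component_eig_bounds {n r : ℕ} (hrn : r ≤ n)
    (Λ : Matrix (Fin n) (Fin r) ℝ) (ΓF : Matrix (Fin r) (Fin r) ℝ) (hΓF : ΓF.PosDef)
    (hχ : (Λ * ΓF * Λᵀ).IsHermitian) (hΛ : (Λᵀ * Λ).IsHermitian) :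
    ∀ j : Fin r,
      (⨅ i, hΓF.1.eigenvalues i) * eigDesc hΛ j ≤ eigDesc hχ (Fin.castLE hrn j) ∧
      eigDesc hχ (Fin.castLE hrn j) ≤ (⨆ i, hΓF.1.eigenvalues i) * eigDesc hΛ j := by
  intro j
  have hΛt : (Λ * Λᵀ).IsHermitian := by
    simpa using isHermitian_mul_conjTranspose_self Λ
  have hpχ : (Λ * ΓF * Λᵀ).PosSemidef := by
    simpa using hΓF.posSemidef.mul_mul_conjTranspose_same Λ
  have hpΛ : (Λᵀ * Λ).PosSemidef := by
    simpa using posSemidef_conjTranspose_mul_self Λ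
  have hχ0 : 0 ≤ eigDesc hχ (Fin.castLE hrn j) := hpχ.eigenvalues_nonneg _
  have hΛ0 : 0 ≤ eigDesc hΛ j := hpΛ.eigenvalues_nonneg _
  have hqχ : ∀ x, x ⬝ᵥ (Λ * ΓF * Λᵀ) *ᵥ x = (Λᵀ *ᵥ x) ⬝ᵥ ΓF *ᵥ (Λᵀ *ᵥ x) := fun x => by
    rw [← mulVec_mulVec, ← mulVec_mulVec, dotProduct_mulVec, ← mulVec_transpose]
  have hqΛ : ∀ x, x ⬝ᵥ (Λ * Λᵀ) *ᵥ x = (Λᵀ *ᵥ x) ⬝ᵥ (Λᵀ *ᵥ x) := fun x => by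
    rw [← mulVec_mulVec, dotProduct_mulVec, ← mulVec_transpose]
  have hmin : 0 ≤ ⨅ i, hΓF.1.eigenvalues i := Real.iInf_nonneg fun i => (hΓF.eigenvalues_pos i).le
  have hmax : 0 < ⨆ i, hΓF.1.eigenvalues i :=
    (hΓF.eigenvalues_pos j).trans_le (le_ciSup (Set.finite_range _).bddAbove j)
  constructor
  · rcases hΛ0.eq_or_lt with h0 | hpos
    · rwa [← h0, mul_zero]
    · rw [le_eigDesc_iff, Fin.val_castLE]
      refine ((le_eigDesc_iff hΛ j _).mp le_rfl).trans_le ?_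
      rw [← card_le_eigenvalues_mul_transpose hrn Λ hΛt hΛ hpos]
      refine hΛt.card_le_eigenvalues_mono hχ fun x hx => ?_
      rw [hqΛ] at hx
      rw [hqχ, mul_assoc]
      exact (mul_le_mul_of_nonneg_left hx hmin).trans (hΓF.1.iInf_eigenvalues_mul_le _)
  · rcases hχ0.eq_or_lt with h0 | hpos
    · rw [← h0]
      exact mul_nonneg hmax.le hΛ0
    · rw [← div_le_iff₀' hmax, le_eigDesc_iff,
        ← card_le_eigenvalues_mul_transpose hrn Λ hΛt hΛ (div_pos hpos hmax)]
      refine ((le_eigDesc_iff hχ (Fin.castLE hrn j) _).mp le_rfl).trans_le ?_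
      refine hχ.card_le_eigenvalues_mono hΛt fun x hx => ?_
      rw [hqχ] at hx
      rw [hqΛ, div_mul_eq_mul_div, div_le_iff₀' hmax]
      exact hx.trans (hΓF.1.le_iSup_eigenvalues_mul _)
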